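/- arXiv:1902.03226 — 2 statements merged into one kernel-verified Lean document; each statement's English description precedes it below -/
import Mathlib

section
/- Fix a natural number n ≥ 1, J₀ > 0 and J ∈ ℝ with J ≠ J₀ and J ≠ −J₀. Regard C₁, C₂, C₃, Δ, ξ₀ = 1/C₃ as functions of β > 0. Then there exists β₀ > 0 such that Δ(β) > 0 for all β > β₀, and with ξ₃ = √Δ/C₃ the quantity F(β) = (1/(2ξ₀))·(ξ₀+ξ₃)^{2^n}·((C₁+C₂+C₃)/4)^{2^n−1} tends to 1 as β → +∞. (F(β) is the value φ₁(Pₙ) = φ₂(Qₙ) of the two ordered quantum Markov chains on the all-spin-up, respectively all-spin-down, projection over the volume Λₙ.) -/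
noncomputable section

def C₁ (J₀ J β : ℝ) : ℝ :=
  (1/4) * (Real.exp (4 * J₀ * β) + 1) + (1/2) * Real.exp (2 * J₀ * β) * Real.cosh (2 * J * β)

def C₂ (J₀ J β : ℝ) : ℝ :=
  (1/4) * (Real.exp (4 * J₀ * β) + 1) - (1/2) * Real.exp (2 * J₀ * β) * Real.cosh (2 * J * β)

def C₃ (J₀ J β : ℝ) : ℝ := (1/2) * (Real.exp (4 * J₀ * β) - 1)

def Δ (J₀ J β : ℝ) : ℝ := (C₃ J₀ J β - C₁ J₀ J β) / C₂ J₀ J β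

def ξ₀ (J₀ J β : ℝ) : ℝ := 1 / C₃ J₀ J β

def ξ₃ (J₀ J β : ℝ) : ℝ := Real.sqrt (Δ J₀ J β) / C₃ J₀ J β

open Filter Topology

lemma four_mul_C₂ (J₀ J β : ℝ) :
    4 * C₂ J₀ J β =
      (Real.exp (2 * (J₀ + J) * β) - 1) * (Real.exp (2 * (J₀ - J) * β) - 1) := by
  have h1 : Real.exp (4 * J₀ * β) =
      Real.exp (2 * (J₀ + J) * β) * Real.exp (2 * (J₀ - J) * β) := by
    rw [← Real.exp_add]; ring_nf
  have h2 : Real.exp (2 * (J₀ + J) * β) = Real.exp (2 * J₀ * β) * Real.exp (2 * J * β) := by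
    rw [← Real.exp_add]; ring_nf
  have h3 : Real.exp (2 * (J₀ - J) * β) = Real.exp (2 * J₀ * β) * Real.exp (-(2 * J * β)) := by
    rw [← Real.exp_add]; ring_nf
  rw [C₂, Real.cosh_eq, h1, h2, h3]
  ring

lemma exp_mul_sub_one_ne_zero {p β : ℝ} (hp : p ≠ 0) (hβ : β ≠ 0) :
    Real.exp (p * β) - 1 ≠ 0 := by
  rw [sub_ne_zero, Ne, Real.exp_eq_one_iff]
  exact mul_ne_zero hp hβ

lemma C₂_ne_zero {J₀ J β : ℝ} (h₁ : J ≠ J₀) (h₂ : J ≠ -J₀) (hβ : β ≠ 0) : C₂ J₀ J β ≠ 0 := by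
  have hp : 2 * (J₀ + J) ≠ 0 := fun h => h₂ (by linarith)
  have hq : 2 * (J₀ - J) ≠ 0 := fun h => h₁ (by linarith)
  have h := mul_ne_zero (exp_mul_sub_one_ne_zero hp hβ) (exp_mul_sub_one_ne_zero hq hβ)
  rw [← four_mul_C₂] at h
  exact right_ne_zero_of_mul h

lemma tendsto_inv_exp_mul_sub_one_of_pos {p : ℝ} (hp : 0 < p) :
    Tendsto (fun β : ℝ => (Real.exp (p * β) - 1)⁻¹) atTop (𝓝 0) :=
  tendsto_inv_atTop_zero.comp <| tendsto_atTop_add_const_right _ (-1) <|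
    Real.tendsto_exp_atTop.comp <| tendsto_id.const_mul_atTop hp

lemma exists_tendsto_inv_exp_mul_sub_one {p : ℝ} (hp : p ≠ 0) :
    ∃ l, Tendsto (fun β : ℝ => (Real.exp (p * β) - 1)⁻¹) atTop (𝓝 l) := by
  rcases hp.lt_or_gt with hp | hp
  · have h : Tendsto (fun β : ℝ => Real.exp (p * β)) atTop (𝓝 0) :=
      Real.tendsto_exp_atBot.comp (tendsto_id.const_mul_atTop_of_neg hp)
    exact ⟨_, (h.sub_const 1).inv₀ (by norm_num)⟩
  · exact ⟨0, tendsto_inv_exp_mul_sub_one_of_pos hp⟩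

lemma tendsto_inv_C₂ {J₀ J : ℝ} (hJ₀ : 0 < J₀) (h₁ : J ≠ J₀) (h₂ : J ≠ -J₀) :
    Tendsto (fun β : ℝ => (C₂ J₀ J β)⁻¹) atTop (𝓝 0) := by
  have hp : 2 * (J₀ + J) ≠ 0 := fun h => h₂ (by linarith)
  have hq : 2 * (J₀ - J) ≠ 0 := fun h => h₁ (by linarith)
  obtain ⟨l, hl⟩ := exists_tendsto_inv_exp_mul_sub_one hp
  obtain ⟨m, hm⟩ := exists_tendsto_inv_exp_mul_sub_one hq
  have hlm : l * m = 0 := by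
    rcases le_or_gt 0 J with hJ | hJ
    · rw [tendsto_nhds_unique hl
        (tendsto_inv_exp_mul_sub_one_of_pos (by linarith)), zero_mul]
    · rw [tendsto_nhds_unique hm
        (tendsto_inv_exp_mul_sub_one_of_pos (by linarith)), mul_zero]
  have h := (hl.mul hm).const_mul 4
  rw [hlm, mul_zero] at h
  refine h.congr fun β => ?_
  rw [← mul_inv, ← four_mul_C₂, mul_inv, mul_inv_cancel_left₀ four_ne_zero]

lemma Δ_eq_one_sub_inv {J₀ J β : ℝ} (h : C₂ J₀ J β ≠ 0) : Δ J₀ J β = 1 - (C₂ J₀ J β)⁻¹ := by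
  have h' : C₃ J₀ J β - C₁ J₀ J β = C₂ J₀ J β - 1 := by
    rw [C₁, C₂, C₃]; ring
  rw [Δ, h', sub_div, div_self h, one_div]

lemma tendsto_Δ {J₀ J : ℝ} (hJ₀ : 0 < J₀) (h₁ : J ≠ J₀) (h₂ : J ≠ -J₀) :
    Tendsto (fun β : ℝ => Δ J₀ J β) atTop (𝓝 1) := by
  have h := (tendsto_inv_C₂ hJ₀ h₁ h₂).const_sub 1
  rw [sub_zero] at h
  refine h.congr' ?_
  filter_upwards [eventually_ne_atTop 0] with β hβ
  rw [Δ_eq_one_sub_inv (C₂_ne_zero h₁ h₂ hβ)]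

lemma C₁_add_C₂_add_C₃ (J₀ J β : ℝ) :
    C₁ J₀ J β + C₂ J₀ J β + C₃ J₀ J β = Real.exp (4 * J₀ * β) := by
  rw [C₁, C₂, C₃]; ring

lemma phi_Pn_eq {J₀ J β : ℝ} (h : Real.exp (4 * J₀ * β) - 1 ≠ 0) {N : ℕ} (hN : N ≠ 0) :
    (1 / (2 * ξ₀ J₀ J β)) * (ξ₀ J₀ J β + ξ₃ J₀ J β) ^ N
        * ((C₁ J₀ J β + C₂ J₀ J β + C₃ J₀ J β) / 4) ^ (N - 1) =
      ((1 + √(Δ J₀ J β)) / 2) ^ N * (1 + (Real.exp (4 * J₀ * β) - 1)⁻¹) ^ (N - 1) := by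
  obtain ⟨k, rfl⟩ := Nat.exists_eq_succ_of_ne_zero hN
  have hinv : 1 + (Real.exp (4 * J₀ * β) - 1)⁻¹ =
      Real.exp (4 * J₀ * β) / (Real.exp (4 * J₀ * β) - 1) := by
    field_simp
    ring
  rw [C₁_add_C₂_add_C₃, ξ₃, ξ₀, C₃, hinv, Nat.succ_eq_add_one, Nat.add_sub_cancel]
  generalize √(Δ J₀ J β) = s
  generalize Real.exp (4 * J₀ * β) = b at *
  rw [← add_div, pow_succ, pow_succ]
  have hk : ((1 + s) / (1 / 2 * (b - 1))) ^ k * (b / 4) ^ k =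
      ((1 + s) / 2) ^ k * (b / (b - 1)) ^ k := by
    rw [← mul_pow, ← mul_pow]
    congr 1
    field_simp
    ring
  have h1 : 1 / (2 * (1 / (1 / 2 * (b - 1)))) * ((1 + s) / (1 / 2 * (b - 1))) =
      (1 + s) / 2 := by
    field_simp
  linear_combination ((1 + s) / 2) * hk +
    ((1 + s) / (1 / 2 * (b - 1))) ^ k * (b / 4) ^ k * h1

theorem phi_Pn_tendsto_one (n : ℕ) (hn : 1 ≤ n) (J₀ J : ℝ) (hJ₀ : 0 < J₀)
    (h₁ : J ≠ J₀) (h₂ : J ≠ -J₀) :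
    (∃ β₀ > (0:ℝ), ∀ β > β₀, 0 < Δ J₀ J β) ∧
    Filter.Tendsto
      (fun β : ℝ =>
        (1 / (2 * ξ₀ J₀ J β)) * (ξ₀ J₀ J β + ξ₃ J₀ J β) ^ (2 ^ n)
          * ((C₁ J₀ J β + C₂ J₀ J β + C₃ J₀ J β) / 4) ^ (2 ^ n - 1))
      Filter.atTop (nhds 1) := by
  have hΔ := tendsto_Δ hJ₀ h₁ h₂
  constructor
  · obtain ⟨B, hB⟩ := eventually_atTop.1 (hΔ.eventually_const_lt one_pos)
    exact ⟨max B 1, by positivity, fun β hβ => hB β ((le_max_left _ _).trans hβ.le)⟩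
  · have hb := tendsto_inv_exp_mul_sub_one_of_pos (p := 4 * J₀) (by positivity)
    have h := ((((hΔ.sqrt.const_add 1).div_const 2).pow (2 ^ n)).mul
      ((hb.const_add 1).pow (2 ^ n - 1)))
    have hlim : ((1 + √(1 : ℝ)) / 2) ^ 2 ^ n * (1 + (0 : ℝ)) ^ (2 ^ n - 1) = 1 := by
      norm_num
    rw [hlim] at h
    refine h.congr' ?_
    filter_upwards [eventually_ne_atTop 0] with β hβ
    exact (phi_Pn_eq (exp_mul_sub_one_ne_zero (by positivity) hβ) (by positivity)).symm
end
end

section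
/- Let J₀, J, β be real and let h = s·I₂ + t·σz with s, t real. Then: (a) the normalized partial trace onto the first tensor factor of A·(I₂⊗I₂⊗h)·A* equals C₁·s·I₂ + (C₃/2)·t·σz; and (b) the normalized partial trace onto the first tensor factor of A·(I₂⊗σz⊗h)·A* equals C₂·t·I₂ + (C₃/2)·s·σz. -/
open Matrix Kronecker

noncomputable section

def σx : Matrix (Fin 2) (Fin 2) ℂ := !![0, 1; 1, 0]
def σy : Matrix (Fin 2) (Fin 2) ℂ := !![0, -Complex.I; Complex.I, 0]
def σz : Matrix (Fin 2) (Fin 2) ℂ := !![1, 0; 0, -1]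

abbrev M8 := Matrix (Fin 2 × Fin 2 × Fin 2) (Fin 2 × Fin 2 × Fin 2) ℂ

def I2 : Matrix (Fin 2) (Fin 2) ℂ := 1

/-- The operator `A = γ₁ I⊗I⊗I + γ₂ I⊗σx⊗σx + γ₂ I⊗σy⊗σy + γ₃ I⊗σz⊗σz
  + δ₁ σz⊗I⊗σz + δ₁ σz⊗σz⊗I`. -/
def A (J₀ J β : ℝ) : M8 :=
  ((1/4) * (Real.exp (2 * J₀ * β) + 1 + 2 * Real.exp (J₀ * β) * Real.cosh (J * β))) • (I2 ⊗ₖ (I2 ⊗ₖ I2))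
  + ((1/2) * Real.exp (J₀ * β) * Real.sinh (J * β)) • (I2 ⊗ₖ (σx ⊗ₖ σx))
  + ((1/2) * Real.exp (J₀ * β) * Real.sinh (J * β)) • (I2 ⊗ₖ (σy ⊗ₖ σy))
  + ((1/4) * (Real.exp (2 * J₀ * β) + 1 - 2 * Real.exp (J₀ * β) * Real.cosh (J * β))) • (I2 ⊗ₖ (σz ⊗ₖ σz))
  + ((1/4) * (Real.exp (2 * J₀ * β) - 1)) • (σz ⊗ₖ (I2 ⊗ₖ σz))
  + ((1/4) * (Real.exp (2 * J₀ * β) - 1)) • (σz ⊗ₖ (σz ⊗ₖ I2))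

/-- Normalized partial trace onto the first tensor factor:
  `tr₂₃(M)(i,i′) = (1/4)·Σ_{j,k} M((i,j,k),(i′,j,k))`. -/
def ptr (M : M8) : Matrix (Fin 2) (Fin 2) ℂ :=
  Matrix.of fun i i' => (1/4 : ℂ) * ∑ j : Fin 2, ∑ k : Fin 2, M (i, j, k) (i', j, k)

/-- The explicit entries of `A`: it is block diagonal in the first tensor factor, and each block acts
diagonally on `|00⟩`, `|11⟩` and hyperbolically on the span of `|01⟩`, `|10⟩`. -/
lemma A_apply (J₀ J β : ℝ) (i j k i' j' k' : Fin 2) :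
    A J₀ J β (i, j, k) (i', j', k') =
      if i ≠ i' then 0
      else if j = k then
        if j = j' ∧ k = k' then (if i = j then ((Real.exp (J₀ * β) ^ 2 : ℝ) : ℂ) else 1) else 0
      else if j = j' ∧ k = k' then ((Real.exp (J₀ * β) * Real.cosh (J * β) : ℝ) : ℂ)
      else if j = k' ∧ k = j' then ((Real.exp (J₀ * β) * Real.sinh (J * β) : ℝ) : ℂ)
      else 0 := by
  have hexp : Real.exp (2 * J₀ * β) = Real.exp (J₀ * β) ^ 2 := by
    rw [← Real.exp_nat_mul]; congr 1; push_cast; ring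
  rw [A, hexp]
  generalize Real.exp (J₀ * β) = e
  generalize Real.cosh (J * β) = c
  generalize Real.sinh (J * β) = d
  fin_cases i <;> fin_cases i' <;> fin_cases j <;> fin_cases k <;> fin_cases j' <;>
    fin_cases k' <;>
    simp [Matrix.add_apply, Matrix.smul_apply, kroneckerMap_apply, I2, σx, σy, σz] <;> ring

theorem ptr_A_transfer (J₀ J β s t : ℝ) :
    let h : Matrix (Fin 2) (Fin 2) ℂ := s • I2 + t • σz
    ptr (A J₀ J β * (I2 ⊗ₖ (I2 ⊗ₖ h)) * (A J₀ J β)ᴴ)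
      = (C₁ J₀ J β * s) • I2 + ((C₃ J₀ J β / 2) * t) • σz ∧
    ptr (A J₀ J β * (I2 ⊗ₖ (σz ⊗ₖ h)) * (A J₀ J β)ᴴ)
      = (C₂ J₀ J β * t) • I2 + ((C₃ J₀ J β / 2) * s) • σz := by
  intro h
  have hexp₂ : Real.exp (2 * J₀ * β) = Real.exp (J₀ * β) ^ 2 := by
    rw [← Real.exp_nat_mul]; congr 1; push_cast; ring
  have hexp₄ : Real.exp (4 * J₀ * β) = Real.exp (J₀ * β) ^ 4 := by
    rw [← Real.exp_nat_mul]; congr 1; push_cast; ring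
  have hcosh : Real.cosh (2 * J * β) = Real.cosh (J * β) ^ 2 + Real.sinh (J * β) ^ 2 := by
    rw [mul_assoc, Real.cosh_two_mul]
  have hA := A_apply J₀ J β
  rw [C₁, C₂, C₃, hexp₂, hexp₄, hcosh]
  generalize Real.exp (J₀ * β) = e at *
  generalize Real.cosh (J * β) = c at *
  generalize Real.sinh (J * β) = d at *
  constructor <;> ext i i' <;> fin_cases i <;> fin_cases i' <;>
    simp [h, ptr, Matrix.mul_apply, Fintype.sum_prod_type, hA, kroneckerMap_apply, I2, σz,
      Matrix.one_apply] <;> ring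
end
end
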